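/- Suppose N : [x₊, X] → ℝ is measurable with 0 < L_m ≤ N(x) ≤ N_m < ∞, and for all L ∈ [0, L_m): arcsin(L)/L = ∫_{x₋}^{X} dx/√(N(x)² − L²) (with the left side interpreted as 1 at L = 0). Then for every n ∈ ℕ, the odd moment identity ∫_{x₋}^{X} N(x)^{−(2n+1)} dx = 1/(2n+1) holds. -/

import Mathlib

open MeasureTheory Filter Topology

/-- Taylor coefficients of `(1 - t)^(-1/2)`. -/
noncomputable def cf (n : ℕ) : ℝ := Ring.choose ((1/2:ℝ) + n - 1) n

lemma cf_pos (n : ℕ) : 0 < cf n := by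
  unfold cf
  rw [← Ring.multichoose_eq]
  have h := Ring.factorial_nsmul_multichoose_eq_ascPochhammer (1/2:ℝ) n
  rw [Polynomial.ascPochhammer_smeval_eq_eval] at h
  have h2 := ascPochhammer_pos n (1/2:ℝ) (by norm_num)
  rw [← h, nsmul_eq_mul] at h2
  exact pos_of_mul_pos_right h2 (by positivity)

lemma cf_hasSum (t : ℝ) (ht : |t| < 1) :
    HasSum (fun n => cf n * t ^ n) (1 / Real.sqrt (1 - t)) := by
  have h := Real.one_div_one_sub_rpow_hasFPowerSeriesOnBall_zero (1/2:ℝ)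
  have h2 := h.hasSum (y := t) (by simpa [enorm_eq_nnnorm] using! ht)
  simpa [FormalMultilinearSeries.ofScalars, cf, Real.sqrt_eq_rpow, mul_comm] using h2

lemma key {μ : Measure ℝ} [IsFiniteMeasure μ] (g w : ℝ → ℝ) (C M : ℝ) (hM : 0 < M) (hC : 0 ≤ C)
    (hg : AEStronglyMeasurable g μ) (hw : AEStronglyMeasurable w μ)
    (hgC : ∀ᵐ x ∂μ, |g x| ≤ C) (hwM : ∀ᵐ x ∂μ, |w x| ≤ M) :
    HasFPowerSeriesAt (fun t => ∫ x, g x * (1 / Real.sqrt (1 - t * w x ^ 2)) ∂μ)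
      (.ofScalars ℝ fun n => cf n * ∫ x, g x * w x ^ (2 * n) ∂μ) 0 := by
  rw [hasFPowerSeriesAt_iff]
  have hev : ∀ᶠ t : ℝ in 𝓝 0, |t| * M ^ 2 < 1 := by
    have : Tendsto (fun t : ℝ => |t| * M ^ 2) (𝓝 0) (𝓝 (|0| * M ^ 2)) :=
      (Continuous.tendsto (by fun_prop) 0)
    simp only [abs_zero, zero_mul] at this
    exact this.eventually (gt_mem_nhds one_pos)
  filter_upwards [hev] with t ht
  have hbound : ∀ n : ℕ, ∀ᵐ x ∂μ, ‖g x * (cf n * (t * w x ^ 2) ^ n)‖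
      ≤ C * (cf n * (|t| * M ^ 2) ^ n) := by
    intro n
    filter_upwards [hgC, hwM] with x h1 h2
    rw [norm_mul, norm_mul, norm_pow, norm_mul, norm_pow]
    simp only [Real.norm_eq_abs, abs_of_pos (cf_pos n)]
    have := (cf_pos n).le
    gcongr
  have hmeas : ∀ n : ℕ, AEStronglyMeasurable (fun x => g x * (cf n * (t * w x ^ 2) ^ n)) μ := by
    intro n
    exact hg.mul (((hw.pow 2).const_mul t |>.pow n).const_mul (cf n))
  have hint : ∀ n : ℕ, Integrable (fun x => g x * (cf n * (t * w x ^ 2) ^ n)) μ := fun n =>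
    Integrable.of_bound (hmeas n) _ (hbound n)
  have hs : Summable fun n : ℕ => C * (cf n * (|t| * M ^ 2) ^ n) :=
    ((cf_hasSum (|t| * M ^ 2) (by rw [abs_of_nonneg (by positivity)]; exact ht)).summable).mul_left C
  have hsum : Summable fun n : ℕ => ∫ x, ‖g x * (cf n * (t * w x ^ 2) ^ n)‖ ∂μ := by
    refine Summable.of_nonneg_of_le (fun n => integral_nonneg fun x => norm_nonneg _) (fun n => ?_)
      (hs.mul_left (μ.real Set.univ))
    calc _ ≤ ∫ x, C * (cf n * (|t| * M ^ 2) ^ n) ∂μ :=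
          integral_mono_ae (hint n).norm (integrable_const _) (hbound n)
      _ = _ := by simp
  have h := hasSum_integral_of_summable_integral_norm hint hsum
  convert h using 1
  · ext n
    simp only [FormalMultilinearSeries.coeff_ofScalars, smul_eq_mul]
    rw [← integral_const_mul, ← integral_const_mul]
    congr 1; ext x; ring
  · refine integral_congr_ae ?_
    filter_upwards [hwM] with x h2
    rw [zero_add]
    refine (HasSum.tsum_eq ?_).symm
    refine (cf_hasSum _ ?_).mul_left _
    rw [abs_mul, abs_pow]
    refine lt_of_le_of_lt ?_ ht
    gcongr

lemma arcsin_int (L : ℝ) (h0 : 0 < L) (h1 : L < 1) :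
    ∫ s in (0:ℝ)..1, 1 / Real.sqrt (1 - L ^ 2 * s ^ 2) = Real.arcsin L / L := by
  have hlt : ∀ s ∈ Set.uIcc (0:ℝ) 1, L * s < 1 ∧ 0 ≤ L * s := by
    intro s hs
    rw [Set.uIcc_of_le zero_le_one] at hs
    exact ⟨by nlinarith [hs.1, hs.2], mul_nonneg h0.le hs.1⟩
  have hd : ∀ s ∈ Set.uIcc (0:ℝ) 1,
      HasDerivAt (fun s => Real.arcsin (L * s) / L) (1 / Real.sqrt (1 - L ^ 2 * s ^ 2)) s := by
    intro s hs
    obtain ⟨ha, hb⟩ := hlt s hs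
    have h := ((Real.hasDerivAt_arcsin (x := L * s) (by linarith) (by linarith)).comp s
      ((hasDerivAt_id s).const_mul L)).div_const L
    have e : 1 / Real.sqrt (1 - (L * s) ^ 2) * (L * 1) / L
        = 1 / Real.sqrt (1 - L ^ 2 * s ^ 2) := by
      rw [mul_pow, mul_one, mul_div_assoc, div_self h0.ne', mul_one]
    rw [← e]
    exact h
  rw [intervalIntegral.integral_eq_sub_of_hasDerivAt hd]
  · simp
  · apply ContinuousOn.intervalIntegrable
    refine ContinuousOn.div (by fun_prop) (by fun_prop) ?_
    intro s hs
    obtain ⟨ha, hb⟩ := hlt s hs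
    have : 0 < 1 - L ^ 2 * s ^ 2 := by nlinarith
    positivity

/-- If `N` is measurable with `0 < L_m ≤ N ≤ N_m < ∞` on `[x₋, X]` and satisfies
`arcsin(L)/L = ∫_{x₋}^{X} dx/√(N(x)² − L²)` for all `L ∈ [0, L_m)` (left side read as `1`
at `L = 0`), then the odd moments satisfy `∫_{x₋}^{X} N(x)^{−(2n+1)} dx = 1/(2n+1)`. -/
theorem stmt15 (xm X Lm Nm : ℝ) (hx : xm < X) (hLm : 0 < Lm) (hNm : Lm ≤ Nm)
    (N : ℝ → ℝ) (hmeas : Measurable N)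
    (hbd : ∀ x ∈ Set.Icc xm X, Lm ≤ N x ∧ N x ≤ Nm)
    (heq : ∀ L ∈ Set.Ico (0:ℝ) Lm,
      (if L = 0 then 1 else Real.arcsin L / L)
        = ∫ x in xm..X, 1 / Real.sqrt ((N x) ^ 2 - L ^ 2)) :
    ∀ n : ℕ, (∫ x in xm..X, 1 / (N x) ^ (2 * n + 1)) = 1 / (2 * (n:ℝ) + 1) := by
  have hae : ∀ᵐ x ∂(volume.restrict (Set.Ioc xm X)), |1 / N x| ≤ 1 / Lm := by
    filter_upwards [ae_restrict_mem measurableSet_Ioc] with x hx'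
    have := (hbd x ⟨hx'.1.le, hx'.2⟩).1
    have hp : 0 < N x := by linarith
    rw [abs_of_pos (by positivity)]
    gcongr
  have hm : AEStronglyMeasurable (fun x => 1 / N x) (volume.restrict (Set.Ioc xm X)) :=
    (hmeas.const_div 1).aestronglyMeasurable
  have P := key (μ := volume.restrict (Set.Ioc xm X)) (fun x => 1 / N x) (fun x => 1 / N x)
    (1 / Lm) (1 / Lm) (by positivity) (by positivity) hm hm hae hae
  have Q := key (μ := volume.restrict (Set.Ioc (0:ℝ) 1)) (fun _ => 1) (fun x => x)
    1 1 (by positivity) (by positivity) aestronglyMeasurable_const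
      measurable_id.aestronglyMeasurable (by simp) (by
      filter_upwards [ae_restrict_mem measurableSet_Ioc] with x hx'
      rw [abs_of_pos hx'.1]; exact hx'.2)
  have hfr := (P.analyticAt.frequently_eq_iff_eventually_eq Q.analyticAt).1 (by
    have hev : ∀ᶠ t : ℝ in 𝓝[>] 0, t < (min Lm 1) ^ 2 :=
      nhdsWithin_le_nhds (gt_mem_nhds (by positivity))
    have hfr : ∃ᶠ t : ℝ in 𝓝[>] 0, (∫ x in Set.Ioc xm X, 1 / N x *
        (1 / Real.sqrt (1 - t * (1 / N x) ^ 2)))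
        = ∫ x in Set.Ioc (0:ℝ) 1, 1 * (1 / Real.sqrt (1 - t * x ^ 2)) := by
      apply Eventually.frequently
      filter_upwards [hev, self_mem_nhdsWithin] with t ht ht0
      have ht0 : 0 < t := ht0
      obtain ⟨L, hL0, rfl⟩ : ∃ L : ℝ, 0 < L ∧ L ^ 2 = t :=
        ⟨Real.sqrt t, Real.sqrt_pos.2 ht0, Real.sq_sqrt ht0.le⟩
      have hLl : L < min Lm 1 := lt_of_pow_lt_pow_left₀ 2 (by positivity) ht
      have hL1 := hLl.trans_le (min_le_left _ _)
      have hL2 := hLl.trans_le (min_le_right _ _)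
      have h := heq L ⟨hL0.le, hL1⟩
      rw [if_neg hL0.ne', ← arcsin_int L hL0 hL2, intervalIntegral.integral_of_le zero_le_one,
        intervalIntegral.integral_of_le hx.le] at h
      simp only [one_mul]
      rw [h]
      refine setIntegral_congr_fun measurableSet_Ioc ?_
      intro x hx'
      have := (hbd x ⟨hx'.1.le, hx'.2⟩).1
      have hp : 0 < N x := by linarith
      have e : N x ^ 2 - L ^ 2 = N x ^ 2 * (1 - L ^ 2 * (1 / N x) ^ 2) := by field_simp
      simp only
      rw [e, Real.sqrt_mul (by positivity), Real.sqrt_sq hp.le, one_div_mul_one_div]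
    exact hfr.filter_mono (nhdsWithin_mono _ (fun t ht => ne_of_gt ht)))
  have hpq := P.eq_formalMultilinearSeries_of_eventually Q hfr
  intro n
  have hn := congrArg (fun p => p.coeff n) hpq
  simp only [FormalMultilinearSeries.coeff_ofScalars] at hn
  have hn := mul_left_cancel₀ (cf_pos n).ne' hn
  rw [intervalIntegral.integral_of_le hx.le]
  have e1 : ∀ x, 1 / N x ^ (2 * n + 1) = 1 / N x * (1 / N x) ^ (2 * n) := by
    intro x; rw [← pow_succ', one_div_pow]
  simp only [e1]
  rw [hn]
  simp only [one_mul]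
  rw [← intervalIntegral.integral_of_le zero_le_one, integral_pow]
  simp
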